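/- arXiv:2011.08169 — 7 statements merged into one kernel-verified Lean document; each statement's English description precedes it below -/
import Mathlib

section
/- Let G be a simple graph with n vertices and connectivity k, and let T be a tubing of G. Then every inner tube of T is properly contained in every outer tube of T; that is, if t_i ∈ T has at most n−k vertices and t_u ∈ T has more than n−k vertices, then t_i ⊊ t_u. -/
namespace ColorfulGA

variable {V : Type} {α : Type}

/-- A tube of `G`: a nonempty proper subset of the vertices whose induced subgraph
is connected. -/
def IsTube [Fintype V] (G : SimpleGraph V) (t : Finset V) : Prop :=
  t.Nonempty ∧ t ≠ Finset.univ ∧ (G.induce (t : Set V)).Connected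

/-- Two (distinct) tubes are compatible if one properly contains the other, or they are
disjoint and joined by no edge of `G`. -/
def Compatible (G : SimpleGraph V) (t₁ t₂ : Finset V) : Prop :=
  t₁ ⊂ t₂ ∨ t₂ ⊂ t₁ ∨ (Disjoint t₁ t₂ ∧ ∀ u ∈ t₁, ∀ w ∈ t₂, ¬ G.Adj u w)

/-- A tubing of `G`: a set of pairwise compatible tubes. -/
def IsTubing [Fintype V] (G : SimpleGraph V) (T : Finset (Finset V)) : Prop :=
  (∀ t ∈ T, IsTube G t) ∧ ∀ t₁ ∈ T, ∀ t₂ ∈ T, t₁ ≠ t₂ → Compatible G t₁ t₂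

/-- `G` has connectivity `k`: `k ≤ n - 1`, removing any fewer than `k` vertices leaves a
connected induced subgraph, and either some `k` vertices disconnect `G` or `k = n - 1`. -/
def HasConnectivity [Fintype V] [DecidableEq V] (G : SimpleGraph V) (k : ℕ) : Prop :=
  k ≤ Fintype.card V - 1 ∧
  (∀ S : Finset V, S.card < k → (G.induce ((Sᶜ : Finset V) : Set V)).Connected) ∧
  ((∃ S : Finset V, S.card = k ∧ ¬ (G.induce ((Sᶜ : Finset V) : Set V)).Preconnected) ∨
    k = Fintype.card V - 1)

/-- If the subgraph induced on the union of two disjoint nonempty vertex sets is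
preconnected, then some edge joins the two sets. -/
theorem exists_adj_of_preconnected_induce_union [DecidableEq V] {G : SimpleGraph V}
    {s t : Finset V} (hs : s.Nonempty) (ht : t.Nonempty) (hst : Disjoint s t)
    (h : (G.induce ((s ∪ t : Finset V) : Set V)).Preconnected) :
    ∃ u ∈ s, ∃ w ∈ t, G.Adj u w := by
  obtain ⟨u, hu⟩ := hs
  obtain ⟨w, hw⟩ := ht
  obtain ⟨p⟩ := h ⟨u, by simp [hu]⟩ ⟨w, by simp [hw]⟩
  obtain ⟨d, -, hd₁, hd₂⟩ := p.exists_boundary_dart {x | (x : V) ∈ s} hu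
    (Finset.disjoint_right.mp hst hw)
  exact ⟨d.fst, hd₁, d.snd, (Finset.mem_union.mp d.snd.2).resolve_left hd₂, d.adj⟩

/-- In a tubing of a graph with `n` vertices and connectivity `k`, every inner
tube (at most `n - k` vertices) is properly contained in every outer tube (more than
`n - k` vertices). -/
theorem inner_ssubset_outer [Fintype V] [DecidableEq V] (G : SimpleGraph V) (n k : ℕ)
    (hn : Fintype.card V = n) (hGk : HasConnectivity G k)
    (T : Finset (Finset V)) (hT : IsTubing G T)
    (ti tu : Finset V) (hi : ti ∈ T) (hu : tu ∈ T)
    (hinner : ti.card ≤ n - k) (houter : n - k < tu.card) :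
    ti ⊂ tu := by
  have hne : ti ≠ tu := by
    rintro rfl
    omega
  obtain h | h | ⟨hdisj, hadj⟩ := hT.2 ti hi tu hu hne
  · exact h
  · have := Finset.card_lt_card h
    omega
  · have hti := (hT.1 ti hi).1
    have hpos := hti.card_pos
    have hlt : (ti ∪ tu)ᶜ.card < k := by
      have := Finset.card_le_univ (ti ∪ tu)
      rw [Finset.card_compl, Finset.card_union_of_disjoint hdisj] at *
      omega
    have hconn := (hGk.2.1 _ hlt).preconnected
    rw [compl_compl] at hconn
    obtain ⟨u, hut, w, hwt, huw⟩ :=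
      exists_adj_of_preconnected_induce_union hti (hT.1 tu hu).1 hdisj hconn
    exact (hadj u hut w hwt huw).elim

end ColorfulGA
end

section
/- Let G be a simple graph with n vertices and connectivity k. If t₁ and t₂ are distinct compatible tubes of G each having more than n−k vertices, then one of t₁, t₂ properly contains the other. -/
namespace ColorfulGA

variable {V : Type} {α : Type}

/-- If `s ∪ t` induces a preconnected subgraph, `s` is nonempty and no edge joins `s` to `t`,
then `t` is contained in `s`. -/
theorem mem_of_induce_union_preconnected [DecidableEq V] {G : SimpleGraph V} {s t : Finset V}
    (hconn : (G.induce ((s ∪ t : Finset V) : Set V)).Preconnected)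
    (hadj : ∀ u ∈ s, ∀ w ∈ t, ¬ G.Adj u w) {u w : V} (hu : u ∈ s) (hw : w ∈ t) : w ∈ s := by
  have key : ∀ (a b : ((s ∪ t : Finset V) : Set V))
      (_ : (G.induce ((s ∪ t : Finset V) : Set V)).Walk a b), a.1 ∈ s → b.1 ∈ s := by
    intro a b p
    induction p with
    | nil => exact id
    | @cons a c _ h _ ih =>
      intro ha
      refine ih ((Finset.mem_union.mp (Finset.mem_coe.mp c.2)).resolve_right fun hc => ?_)
      exact hadj _ ha _ hc h
  obtain ⟨p⟩ := hconn ⟨u, Finset.mem_coe.mpr (Finset.mem_union_left t hu)⟩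
    ⟨w, Finset.mem_coe.mpr (Finset.mem_union_right s hw)⟩
  exact key _ _ p hu

/-- Two distinct compatible outer tubes (each with more than `n - k` vertices)
of a graph with `n` vertices and connectivity `k` are nested: one properly contains the
other. -/
theorem outer_tubes_nested [Fintype V] [DecidableEq V] (G : SimpleGraph V) (n k : ℕ)
    (hn : Fintype.card V = n) (hGk : HasConnectivity G k)
    (t₁ t₂ : Finset V) (ht₁ : IsTube G t₁) (ht₂ : IsTube G t₂) (hne : t₁ ≠ t₂)
    (hcomp : Compatible G t₁ t₂)
    (ho₁ : n - k < t₁.card) (ho₂ : n - k < t₂.card) :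
    t₁ ⊂ t₂ ∨ t₂ ⊂ t₁ := by
  rcases hcomp with h | h | ⟨hdisj, hadj⟩
  · exact Or.inl h
  · exact Or.inr h
  · exfalso
    obtain ⟨u, hu⟩ := ht₁.1
    obtain ⟨w, hw⟩ := ht₂.1
    have hunion := Finset.card_union_of_disjoint hdisj
    have hle := Finset.card_le_univ (t₁ ∪ t₂)
    have hcompl := Finset.card_compl (t₁ ∪ t₂)
    have hconn := (hGk.2.1 (t₁ ∪ t₂)ᶜ (by omega)).preconnected
    rw [compl_compl] at hconn
    exact Finset.disjoint_left.mp hdisj (mem_of_induce_union_preconnected hconn hadj hu hw) hw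

end ColorfulGA
end

section
/- Let G be a simple graph with n vertices and connectivity k ≥ 1. Every maximal tubing of G (a tubing with n−1 tubes) contains exactly k−1 outer tubes and exactly n−k inner tubes. -/
namespace ColorfulGA

variable {V : Type} {α : Type}

/-- If the union of a nonempty family of pairwise compatible nonempty sets induces a preconnected
graph, then this union is a member of the family. -/
theorem sup_mem_of_preconnected [DecidableEq V] {G : SimpleGraph V} {F : Finset (Finset V)}
    (hF : F.Nonempty) (hne : ∀ t ∈ F, t.Nonempty)
    (hc : ∀ t₁ ∈ F, ∀ t₂ ∈ F, t₁ ≠ t₂ → Compatible G t₁ t₂)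
    (hconn : (G.induce ((F.sup id : Finset V) : Set V)).Preconnected) : F.sup id ∈ F := by
  obtain ⟨t, ht, hmax⟩ := F.exists_max_image Finset.card hF
  have htU : t ⊆ F.sup id := Finset.le_sup (f := id) ht
  by_contra hU
  obtain ⟨y, hyU, hyt⟩ : ∃ y ∈ F.sup id, y ∉ t := by
    by_contra! h
    exact hU ((Finset.Subset.antisymm htU h) ▸ ht)
  obtain ⟨x, hx⟩ := hne t ht
  obtain ⟨p⟩ := hconn ⟨x, htU hx⟩ ⟨y, hyU⟩
  obtain ⟨d, -, hd₁, hd₂⟩ := p.exists_boundary_dart {v | v.1 ∈ t} hx hyt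
  have hadj : G.Adj d.fst.1 d.snd.1 := d.adj
  obtain ⟨s, hs, hds⟩ := Finset.mem_sup.mp d.snd.2
  have hst : t ≠ s := by
    rintro rfl
    exact hd₂ hds
  rcases hc t ht s hs hst with h | h | h
  · exact (Finset.card_lt_card h).not_ge (hmax s hs)
  · exact hd₂ (h.subset hds)
  · exact h.2 _ hd₁ _ hds hadj

/-- The size of a family of pairwise compatible nonempty connected sets is at most the
number of vertices that they cover. -/
theorem card_le_card_sup [DecidableEq V] {G : SimpleGraph V} {F : Finset (Finset V)}
    (hne : ∀ t ∈ F, t.Nonempty) (hconn : ∀ t ∈ F, (G.induce (t : Set V)).Preconnected)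
    (hc : ∀ t₁ ∈ F, ∀ t₂ ∈ F, t₁ ≠ t₂ → Compatible G t₁ t₂) : F.card ≤ (F.sup id).card := by
  have key : ∀ t ∈ F, ∃ x ∈ t, ∀ s ∈ F, s ⊂ t → x ∉ s := by
    intro t ht
    by_contra! h
    have hsup : (F.filter (· ⊂ t)).sup id = t := by
      apply Finset.Subset.antisymm
      · exact Finset.sup_le fun s hs => (Finset.mem_filter.mp hs).2.subset
      · intro x hx
        obtain ⟨s, hs, hst, hxs⟩ := h x hx
        exact Finset.mem_sup.mpr ⟨s, Finset.mem_filter.mpr ⟨hs, hst⟩, hxs⟩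
    have hmem : (F.filter (· ⊂ t)).sup id ∈ F.filter (· ⊂ t) := by
      apply sup_mem_of_preconnected (G := G)
      · obtain ⟨x, hx⟩ := hne t ht
        obtain ⟨s, hs, hst, -⟩ := h x hx
        exact ⟨s, Finset.mem_filter.mpr ⟨hs, hst⟩⟩
      · exact fun s hs => hne s (Finset.mem_filter.mp hs).1
      · exact fun s hs r hr => hc s (Finset.mem_filter.mp hs).1 r (Finset.mem_filter.mp hr).1
      · rw [hsup]
        exact hconn t ht
    rw [hsup] at hmem
    exact (Finset.mem_filter.mp hmem).2.ne rfl
  rcases F.eq_empty_or_nonempty with rfl | ⟨t₀, ht₀⟩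
  · simp
  have : Nonempty V := ⟨(hne t₀ ht₀).choose⟩
  choose! f hft hfs using key
  refine Finset.card_le_card_of_injOn f
    (fun t ht => Finset.mem_sup.mpr ⟨t, ht, hft t ht⟩) fun s hs t ht hst => ?_
  by_contra hne'
  rcases hc s hs t ht hne' with h | h | h
  · exact hfs t ht s hs h (hst ▸ hft s hs)
  · exact hfs s hs t ht h (hst ▸ hft t ht)
  · exact Finset.disjoint_left.mp h.1 (hft s hs) (hst ▸ hft t ht)

/-- In a graph of connectivity `k`, a set inducing a non-preconnected graph misses at least `k`
vertices. -/
theorem HasConnectivity.card_add_le [Fintype V] [DecidableEq V] {G : SimpleGraph V} {k : ℕ}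
    (hG : HasConnectivity G k) {U : Finset V} (hU : ¬ (G.induce (U : Set V)).Preconnected) :
    U.card + k ≤ Fintype.card V := by
  by_contra! h
  have hcompl := U.card_add_card_compl
  have hconn := hG.2.1 Uᶜ (by omega)
  rw [compl_compl] at hconn
  exact hU hconn.preconnected

/-- For a graph with `n` vertices and connectivity `k ≥ 1`, every maximal
tubing (one with `n - 1` tubes) contains exactly `k - 1` outer tubes and exactly `n - k`
inner tubes. -/
theorem maximal_tubing_inner_outer_count [Fintype V] [DecidableEq V] (G : SimpleGraph V)
    (n k : ℕ) (hn : Fintype.card V = n) (hk : 1 ≤ k) (hGk : HasConnectivity G k)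
    (T : Finset (Finset V)) (hT : IsTubing G T) (hmax : T.card = n - 1) :
    (T.filter (fun t => n - k < t.card)).card = k - 1 ∧
      (T.filter (fun t => t.card ≤ n - k)).card = n - k := by
  subst hn
  obtain ⟨htube, hcomp⟩ := hT
  have hkn := hGk.1
  have hinner : (T.filter (fun t => t.card ≤ Fintype.card V - k)).card ≤ Fintype.card V - k := by
    set F := T.filter (fun t => t.card ≤ Fintype.card V - k) with hFdef
    have hFT : ∀ t ∈ F, t ∈ T := fun t ht => (Finset.mem_filter.mp ht).1
    have hFne : ∀ t ∈ F, t.Nonempty := fun t ht => (htube t (hFT t ht)).1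
    have hFc : ∀ t₁ ∈ F, ∀ t₂ ∈ F, t₁ ≠ t₂ → Compatible G t₁ t₂ :=
      fun s hs t ht => hcomp s (hFT s hs) t (hFT t ht)
    rcases F.eq_empty_or_nonempty with hF | hF
    · simp [hF]
    refine (card_le_card_sup hFne (fun t ht => (htube t (hFT t ht)).2.2.preconnected) hFc).trans ?_
    by_cases hU : (G.induce ((F.sup id : Finset V) : Set V)).Preconnected
    · exact (Finset.mem_filter.mp (sup_mem_of_preconnected hF hFne hFc hU)).2
    · have := hGk.card_add_le hU
      omega
  have houter : (T.filter (fun t => Fintype.card V - k < t.card)).card ≤ k - 1 := by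
    have hIoo : (Finset.Ioo (Fintype.card V - k) (Fintype.card V)).card = k - 1 := by
      rw [Nat.card_Ioo]
      omega
    rw [← hIoo]
    refine Finset.card_le_card_of_injOn Finset.card (fun t ht => ?_) fun s hs t ht hst => ?_
    · obtain ⟨htT, htk⟩ := Finset.mem_filter.mp ht
      exact Finset.mem_Ioo.mpr ⟨htk,
        Finset.card_lt_card (Finset.ssubset_univ_iff.mpr (htube t htT).2.1)⟩
    · obtain ⟨hsT, hsk⟩ := Finset.mem_filter.mp hs
      obtain ⟨htT, htk⟩ := Finset.mem_filter.mp ht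
      by_contra hne
      rcases hcomp s hsT t htT hne with h | h | h
      · exact (Finset.card_lt_card h).ne hst
      · exact (Finset.card_lt_card h).ne hst.symm
      · have hcard := Finset.card_union_of_disjoint h.1
        have hs0 := (htube s hsT).1.card_pos
        have ht0 := (htube t htT).1.card_pos
        have hU : ¬ (G.induce ((s ∪ t : Finset V) : Set V)).Preconnected := by
          intro hU
          have hsup : ({s, t} : Finset (Finset V)).sup id = s ∪ t := by simp
          have hsub : ∀ r ∈ ({s, t} : Finset (Finset V)), r ∈ T := by
            simp [hsT, htT]
          have hmem := sup_mem_of_preconnected (G := G) (F := {s, t}) (by simp)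
            (fun r hr => (htube r (hsub r hr)).1)
            (fun q hq r hr => hcomp q (hsub q hq) r (hsub r hr)) (by rwa [hsup])
          rw [hsup, Finset.mem_insert, Finset.mem_singleton] at hmem
          rcases hmem with h | h <;> rw [h] at hcard <;> omega
        have := hGk.card_add_le hU
        omega
  have hsum := T.card_filter_add_card_filter_not (fun t => t.card ≤ Fintype.card V - k)
  simp only [not_le] at hsum
  omega

end ColorfulGA
end

section
/- Let G be a simple graph with n vertices and connectivity k ≥ 1, and let T be a maximal tubing of G. For every integer i with n−k < i < n, there is precisely one tube in T containing exactly i vertices. -/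
namespace ColorfulGA

variable {V : Type} {α : Type}

/-- In a connected induced subgraph, every nonempty proper part is joined to the rest. -/
lemma exists_adj_of_induce_connected {G : SimpleGraph V} {A s : Finset V}
    (hA : (G.induce (A : Set V)).Connected) (hs : s.Nonempty) (hsA : s ⊂ A) :
    ∃ u ∈ s, ∃ w ∈ A, w ∉ s ∧ G.Adj u w := by
  obtain ⟨u, hu⟩ := hs
  obtain ⟨w, hwA, hws⟩ := Finset.exists_of_ssubset hsA
  obtain ⟨p⟩ := hA.preconnected ⟨u, hsA.subset hu⟩ ⟨w, hwA⟩
  obtain ⟨d, -, hd₁, hd₂⟩ := p.exists_boundary_dart {x | (x : V) ∈ s} hu hws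
  exact ⟨d.fst, hd₁, d.snd, d.snd.2, hd₂, d.adj⟩

/-- A connected set covered by those members of a pairwise compatible family that it contains
is itself a member of the family. -/
lemma mem_of_connected_of_cover [DecidableEq V] {G : SimpleGraph V} {F : Finset (Finset V)}
    {A : Finset V} (hF : ∀ s ∈ F, ∀ t ∈ F, s ≠ t → Compatible G s t)
    (hA : (G.induce (A : Set V)).Connected) (hcov : ∀ v ∈ A, ∃ s ∈ F, v ∈ s ∧ s ⊆ A) :
    A ∈ F := by
  obtain ⟨⟨v, hv⟩⟩ := hA.nonempty
  obtain ⟨s₀, hs₀F, hvs₀, hs₀A⟩ := hcov v hv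
  obtain ⟨s, hs, hmax⟩ := (F.filter fun s => s ⊆ A ∧ s.Nonempty).exists_max_image Finset.card
    ⟨s₀, Finset.mem_filter.2 ⟨hs₀F, hs₀A, v, hvs₀⟩⟩
  obtain ⟨hsF, hsA, hsne⟩ := Finset.mem_filter.1 hs
  rcases hsA.eq_or_ssubset with rfl | hss
  · exact hsF
  obtain ⟨u, hu, w, hwA, hws, huw⟩ := exists_adj_of_induce_connected hA hsne hss
  obtain ⟨t, htF, hwt, htA⟩ := hcov w hwA
  have hst : s ≠ t := by
    rintro rfl
    exact hws hwt
  rcases hF s hsF t htF hst with h | h | ⟨-, h⟩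
  · have := hmax t (Finset.mem_filter.2 ⟨htF, htA, w, hwt⟩)
    have := Finset.card_lt_card h
    omega
  · exact absurd (h.subset hwt) hws
  · exact absurd huw (h u hu w hwt)

/-- Each connected member of a pairwise compatible family has a vertex lying in none of the
members properly contained in it. -/
lemma exists_mem_forall_ssubset_notMem [DecidableEq V] {G : SimpleGraph V}
    {F : Finset (Finset V)} (hF : ∀ s ∈ F, ∀ t ∈ F, s ≠ t → Compatible G s t)
    {t : Finset V} (ht : (G.induce (t : Set V)).Connected) :
    ∃ v ∈ t, ∀ s ∈ F, s ⊂ t → v ∉ s := by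
  by_contra! h
  have hmem : t ∈ F.filter (· ⊂ t) := by
    refine mem_of_connected_of_cover (fun s hs r hr => hF s (Finset.mem_filter.1 hs).1 r
      (Finset.mem_filter.1 hr).1) ht fun v hv => ?_
    obtain ⟨s, hs, hst, hvs⟩ := h v hv
    exact ⟨s, Finset.mem_filter.2 ⟨hs, hst⟩, hvs, hst.subset⟩
  exact (Finset.mem_filter.1 hmem).2.ne rfl

/-- Members of a compatible pair that share a vertex are nested. -/
lemma Compatible.ssubset_or_ssubset {G : SimpleGraph V} {s t : Finset V} {v : V}
    (h : Compatible G s t) (hs : v ∈ s) (ht : v ∈ t) : s ⊂ t ∨ t ⊂ s := by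
  rcases h with h | h | ⟨h, -⟩
  · exact Or.inl h
  · exact Or.inr h
  · exact absurd ht (Finset.disjoint_left.1 h hs)

/-- A pairwise compatible family of connected sets with as many members as there are vertices
has, for each member `t`, a vertex `w` of `t` such that the remaining vertices of `t` are
covered by members inside `t \ {w}`. -/
lemma exists_mem_cover_erase [Fintype V] [DecidableEq V] {G : SimpleGraph V}
    {F : Finset (Finset V)} (hF : ∀ s ∈ F, ∀ t ∈ F, s ≠ t → Compatible G s t)
    (hconn : ∀ t ∈ F, (G.induce (t : Set V)).Connected) (hcard : F.card = Fintype.card V)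
    {t : Finset V} (ht : t ∈ F) :
    ∃ w ∈ t, ∀ v ∈ t.erase w, ∃ s ∈ F, v ∈ s ∧ s ⊆ t.erase w := by
  have hex (s : F) := exists_mem_forall_ssubset_notMem hF (hconn s s.2)
  choose f hf hf' using hex
  have hinj : Function.Injective f := by
    intro a b hab
    by_contra hne
    have hb : f a ∈ (b : Finset V) := hab ▸ hf b
    rcases (hF a a.2 b b.2 (Subtype.coe_ne_coe.2 hne)).ssubset_or_ssubset (hf a) hb with h | h
    · exact hf' b a a.2 h (hab ▸ hf a)
    · exact hf' a b b.2 h hb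
  have hbij : Function.Bijective f :=
    (Fintype.bijective_iff_injective_and_card f).2 ⟨hinj, by simpa using hcard⟩
  refine ⟨f ⟨t, ht⟩, hf _, fun v hv => ?_⟩
  obtain ⟨hvne, hvt⟩ := Finset.mem_erase.1 hv
  obtain ⟨s, rfl⟩ := hbij.surjective v
  have hst : (s : Finset V) ≠ t := by
    rintro rfl
    exact hvne rfl
  rcases (hF s s.2 t ht hst).ssubset_or_ssubset (hf s) hvt with h | h
  · exact ⟨s, s.2, hf s, Finset.subset_erase.2 ⟨h.subset, hf' ⟨t, ht⟩ s s.2 h⟩⟩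
  · exact absurd hvt (hf' s t ht h)

/-- In a graph of connectivity `k`, more than `n - k` vertices induce a connected subgraph. -/
lemma HasConnectivity.induce_connected [Fintype V] [DecidableEq V] {G : SimpleGraph V} {k : ℕ}
    (hG : HasConnectivity G k) {A : Finset V} (hA : Fintype.card V - k < A.card) :
    (G.induce (A : Set V)).Connected := by
  have h := hG.2.1 Aᶜ (by have := A.card_compl; have := A.card_le_univ; omega)
  rwa [compl_compl] at h

/-- For a graph with `n` vertices and connectivity `k ≥ 1` and a maximal
tubing `T`, for every `i` with `n - k < i < n` there is exactly one tube in `T` with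
exactly `i` vertices. -/
theorem unique_outer_tube_of_card [Fintype V] [DecidableEq V] (G : SimpleGraph V)
    (n k : ℕ) (hn : Fintype.card V = n) (hk : 1 ≤ k) (hGk : HasConnectivity G k)
    (T : Finset (Finset V)) (hT : IsTubing G T) (hmax : T.card = n - 1)
    (i : ℕ) (hi₁ : n - k < i) (hi₂ : i < n) :
    ∃! t : Finset V, t ∈ T ∧ t.card = i := by
  subst hn
  have hk' := hGk.1
  refine existsUnique_of_exists_of_unique ?_ ?_
  · have huniv : Finset.univ ∉ T := fun h => (hT.1 _ h).2.1 rfl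
    have hss {t : Finset V} (ht : t ∈ T) : t ⊂ Finset.univ :=
      Finset.ssubset_univ_iff.2 (hT.1 t ht).2.1
    have hF : ∀ s ∈ insert Finset.univ T, ∀ t ∈ insert Finset.univ T, s ≠ t →
        Compatible G s t := by
      intro s hs t ht hst
      rcases Finset.mem_insert.1 hs with rfl | hs <;> rcases Finset.mem_insert.1 ht with rfl | ht
      · exact absurd rfl hst
      · exact Or.inr (Or.inl (hss ht))
      · exact Or.inl (hss hs)
      · exact hT.2 s hs t ht hst
    have hconn : ∀ t ∈ insert Finset.univ T, (G.induce (t : Set V)).Connected := by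
      intro t ht
      rcases Finset.mem_insert.1 ht with rfl | ht
      · exact hGk.induce_connected (by rw [Finset.card_univ]; omega)
      · exact (hT.1 t ht).2.2
    have hcard : (insert Finset.univ T).card = Fintype.card V := by
      rw [Finset.card_insert_of_notMem huniv]
      omega
    obtain ⟨t, ht, hmin⟩ := ((insert Finset.univ T).filter fun t => i ≤ t.card).exists_min_image
      Finset.card ⟨Finset.univ, Finset.mem_filter.2
        ⟨Finset.mem_insert_self _ _, by rw [Finset.card_univ]; omega⟩⟩
    obtain ⟨htF, hit⟩ := Finset.mem_filter.1 ht
    rcases hit.eq_or_lt with hit | hit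
    · refine ⟨t, (Finset.mem_insert.1 htF).resolve_left ?_, hit.symm⟩
      rintro rfl
      rw [Finset.card_univ] at hit
      omega
    obtain ⟨w, hw, hcov⟩ := exists_mem_cover_erase hF hconn hcard htF
    have herase := Finset.card_erase_of_mem hw
    have hmem := mem_of_connected_of_cover hF (hGk.induce_connected (by omega)) hcov
    have := hmin _ (Finset.mem_filter.2 ⟨hmem, by omega⟩)
    omega
  · rintro s t ⟨hs, hsi⟩ ⟨ht, hti⟩
    have hle : s.card ≤ (s ∪ t).card := Finset.card_le_card Finset.subset_union_left
    have hmem : s ∪ t ∈ ({s, t} : Finset (Finset V)) := by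
      have hsub : ({s, t} : Finset (Finset V)) ⊆ T := by
        simp [Finset.insert_subset_iff, hs, ht]
      refine mem_of_connected_of_cover (fun a ha b hb => hT.2 a (hsub ha) b (hsub hb))
        (hGk.induce_connected (by omega)) fun v hv => ?_
      rcases Finset.mem_union.1 hv with hv | hv
      · exact ⟨s, by simp, hv, Finset.subset_union_left⟩
      · exact ⟨t, by simp, hv, Finset.subset_union_right⟩
    rcases Finset.mem_insert.1 hmem with h | h
    · exact (Finset.eq_of_subset_of_card_le (Finset.union_eq_left.1 h) (by omega)).symm
    · exact Finset.eq_of_subset_of_card_le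
        (Finset.union_eq_right.1 (Finset.mem_singleton.1 h)) (by omega)

end ColorfulGA
end

section
/- Let G be a finite simple graph, T a tubing of G, and t ∈ T. The map sending a tube h of G to h ∖ ⋃{t' ∈ T : t' ⊊ t} is a bijection from the set of tubes h of G such that (i) h ⊊ t, (ii) h is not contained in any tube t' ∈ T with t' ⊊ t, and (iii) h is compatible with every tube of T, onto the set of tubes of the core graph ℛ(t,T). -/
namespace ColorfulGA

variable {V : Type} {α : Type}

/-- The vertex set of the core graph `ℛ(t, T)`: vertices of `t` not contained in any tube
`t' ∈ T` with `t' ⊊ t`. -/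
def coreVerts [DecidableEq V] (T : Finset (Finset V)) (t : Finset V) : Finset V :=
  t \ (T.filter (fun t' => t' ⊂ t)).sup id

/-- The core graph `ℛ(t, T)` (as a graph on `V`, with all edges between core vertices):
two core vertices are adjacent if they are adjacent in `G` or joined by a path of `G` all
of whose interior vertices lie in a single tube `t' ∈ T` with `t' ⊊ t`. -/
def coreGraph [DecidableEq V] (G : SimpleGraph V) (T : Finset (Finset V)) (t : Finset V) :
    SimpleGraph V :=
  SimpleGraph.fromRel (fun u w => u ∈ coreVerts T t ∧ w ∈ coreVerts T t ∧
    (G.Adj u w ∨ ∃ t' ∈ T, t' ⊂ t ∧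
      ∃ p : G.Walk u w, ∀ x ∈ p.support, x = u ∨ x = w ∨ x ∈ t'))

/-- A tube of the core graph `ℛ(t, T)`: a nonempty proper subset of its vertex set whose
induced subgraph in the core graph is connected. -/
def IsCoreTube [Fintype V] [DecidableEq V] (G : SimpleGraph V) (T : Finset (Finset V))
    (t : Finset V) (s : Finset V) : Prop :=
  s ⊆ coreVerts T t ∧ s.Nonempty ∧ s ≠ coreVerts T t ∧
    ((coreGraph G T t).induce (s : Set V)).Connected

/-- An induced subgraph is connected iff its vertex set is nonempty and every cut of that set
is crossed by an edge. -/
theorem induce_connected_iff_cut (G : SimpleGraph V) (S : Set V) :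
    (G.induce S).Connected ↔ S.Nonempty ∧ ∀ A : Set V, (∃ a ∈ S, a ∈ A) → (∃ b ∈ S, b ∉ A) →
      ∃ a ∈ S, a ∈ A ∧ ∃ b ∈ S, b ∉ A ∧ G.Adj a b := by
  constructor
  · intro h
    obtain ⟨⟨v, hv⟩⟩ := h.nonempty
    refine ⟨⟨v, hv⟩, ?_⟩
    rintro A ⟨a, haS, haA⟩ ⟨b, hbS, hbA⟩
    obtain ⟨p⟩ := h.preconnected ⟨a, haS⟩ ⟨b, hbS⟩
    obtain ⟨d, -, hd₁, hd₂⟩ := p.exists_boundary_dart (Subtype.val ⁻¹' A) haA hbA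
    exact ⟨d.fst, d.fst.2, hd₁, d.snd, d.snd.2, hd₂, d.adj⟩
  · rintro ⟨⟨v, hv⟩, h⟩
    have : Nonempty S := ⟨⟨v, hv⟩⟩
    refine SimpleGraph.Connected.mk ?_
    rintro ⟨u, hu⟩ ⟨w, hw⟩
    by_contra hne
    obtain ⟨a, ha, ⟨ha', har⟩, b, hb, hbA, hab⟩ :=
      h {x | ∃ hx : x ∈ S, (G.induce S).Reachable ⟨u, hu⟩ ⟨x, hx⟩}
        ⟨u, hu, hu, SimpleGraph.Reachable.refl _⟩ ⟨w, hw, fun ⟨_, hr⟩ => hne hr⟩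
    have hab' : (G.induce S).Adj ⟨a, ha'⟩ ⟨b, hb⟩ := hab
    exact hbA ⟨hb, har.trans hab'.reachable⟩

/-- `m` is an inclusion-maximal member of `T` among those properly contained in `t`. -/
def IsMaxBelow (T : Finset (Finset V)) (t m : Finset V) : Prop :=
  Maximal (fun t' => t' ∈ T ∧ t' ⊂ t) m

/-- Some edge of `G` joins `m` to `s`. -/
def Touches (G : SimpleGraph V) (m s : Finset V) : Prop :=
  ∃ x ∈ m, ∃ y ∈ s, G.Adj x y

theorem exists_isMaxBelow {T : Finset (Finset V)} {t t' : Finset V} (h : t' ∈ T) (h' : t' ⊂ t) :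
    ∃ m, IsMaxBelow T t m ∧ t' ⊆ m := by
  classical
  obtain ⟨m, hle, hm⟩ :=
    (T.filter (fun t' => t' ⊂ t)).exists_le_maximal (Finset.mem_filter.2 ⟨h, h'⟩)
  exact ⟨m, by simpa [IsMaxBelow] using hm, hle⟩

theorem mem_sup_below_iff [DecidableEq V] {T : Finset (Finset V)} {t : Finset V} {v : V} :
    v ∈ (T.filter (fun t' => t' ⊂ t)).sup id ↔ ∃ m, IsMaxBelow T t m ∧ v ∈ m := by
  simp only [Finset.mem_sup, Finset.mem_filter, id]
  constructor
  · rintro ⟨t', ⟨h, h'⟩, hv⟩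
    obtain ⟨m, hm, hle⟩ := exists_isMaxBelow h h'
    exact ⟨m, hm, hle hv⟩
  · rintro ⟨m, hm, hv⟩
    exact ⟨m, hm.prop, hv⟩

theorem mem_coreVerts_iff [DecidableEq V] {T : Finset (Finset V)} {t : Finset V} {v : V} :
    v ∈ coreVerts T t ↔ v ∈ t ∧ ∀ m, IsMaxBelow T t m → v ∉ m := by
  simp only [coreVerts, Finset.mem_sdiff, mem_sup_below_iff, not_exists, not_and]

theorem IsTubing.isMaxBelow_eq [Fintype V] {G : SimpleGraph V} {T : Finset (Finset V)}
    (hT : IsTubing G T) {t m m' : Finset V} (hm : IsMaxBelow T t m) (hm' : IsMaxBelow T t m')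
    {x y : V} (hx : x ∈ m) (hy : y ∈ m') (hxy : x = y ∨ G.Adj x y) : m = m' := by
  by_contra hne
  rcases hT.2 m hm.prop.1 m' hm'.prop.1 hne with h | h | ⟨hd, hadj⟩
  · exact hne (hm.eq_of_le hm'.prop h.1)
  · exact hne (hm'.eq_of_le hm.prop h.1).symm
  · rcases hxy with rfl | hxy
    · exact Finset.disjoint_left.1 hd hx hy
    · exact hadj x hx y hy hxy

/-- A maximal tube is joined to any strictly larger connected set by an edge ending outside
every maximal tube. -/
theorem IsTubing.exists_adj_of_isMaxBelow [Fintype V] {G : SimpleGraph V}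
    {T : Finset (Finset V)} (hT : IsTubing G T) {t m S : Finset V} (hm : IsMaxBelow T t m)
    (hS : (G.induce (S : Set V)).Connected) (hmS : m ⊂ S) :
    ∃ x ∈ m, ∃ y ∈ S, G.Adj x y ∧ ∀ m', IsMaxBelow T t m' → y ∉ m' := by
  obtain ⟨-, hcut⟩ := (induce_connected_iff_cut _ _).1 hS
  obtain ⟨v, hv⟩ := (hT.1 m hm.prop.1).1
  obtain ⟨w, hwS, hwm⟩ := Finset.exists_of_ssubset hmS
  obtain ⟨a, -, ham, b, hb, hbm, hab⟩ := hcut (m : Set V) ⟨v, hmS.1 hv, hv⟩ ⟨w, hwS, hwm⟩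
  refine ⟨a, ham, b, hb, hab, fun m' hm' hbm' => hbm ?_⟩
  rw [hT.isMaxBelow_eq hm hm' ham hbm' (Or.inr hab)]
  exact hbm'

theorem adj_or_exists_adj_of_walk {G : SimpleGraph V} {u w : V} (s : Finset V) (p : G.Walk u w)
    (hne : u ≠ w) (hp : ∀ x ∈ p.support, x = u ∨ x = w ∨ x ∈ s) :
    G.Adj u w ∨ ∃ x ∈ s, G.Adj u x := by
  cases p with
  | nil => exact absurd rfl hne
  | @cons _ v _ h q =>
    rcases hp v (by simp) with rfl | rfl | hv
    · exact absurd rfl h.ne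
    · exact Or.inl h
    · exact Or.inr ⟨v, hv, h⟩

theorem exists_walk_through {G : SimpleGraph V} {m : Finset V}
    (hm : (G.induce (m : Set V)).Connected) {u w x y : V} (hx : x ∈ m) (hy : y ∈ m)
    (hux : G.Adj u x) (hwy : G.Adj w y) :
    ∃ p : G.Walk u w, ∀ z ∈ p.support, z = u ∨ z = w ∨ z ∈ m := by
  obtain ⟨q⟩ := hm.preconnected ⟨x, hx⟩ ⟨y, hy⟩
  let q' : G.Walk x y := q.map (SimpleGraph.Embedding.induce (m : Set V)).toHom
  have hq' : ∀ z ∈ q'.support, z ∈ m := by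
    intro z hz
    replace hz := List.mem_map.1 (SimpleGraph.Walk.support_map _ q ▸ hz)
    obtain ⟨z', -, rfl⟩ := hz
    exact z'.2
  refine ⟨SimpleGraph.Walk.cons hux (q'.concat hwy.symm), fun z hz => ?_⟩
  simp only [SimpleGraph.Walk.support_cons, SimpleGraph.Walk.support_concat, List.mem_cons,
    List.mem_append, List.not_mem_nil, or_false] at hz
  rcases hz with h | h | h
  · exact Or.inl h
  · exact Or.inr (Or.inr (hq' z h))
  · exact Or.inr (Or.inl h)

theorem IsTubing.coreGraph_adj_iff [Fintype V] [DecidableEq V] {G : SimpleGraph V}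
    {T : Finset (Finset V)} (hT : IsTubing G T) {t : Finset V} {u w : V} :
    (coreGraph G T t).Adj u w ↔ u ≠ w ∧ u ∈ coreVerts T t ∧ w ∈ coreVerts T t ∧
      (G.Adj u w ∨ ∃ m, IsMaxBelow T t m ∧ (∃ x ∈ m, G.Adj u x) ∧ ∃ y ∈ m, G.Adj w y) := by
  have key : ∀ u w : V, u ≠ w →
      ((G.Adj u w ∨ ∃ t' ∈ T, t' ⊂ t ∧
        ∃ p : G.Walk u w, ∀ x ∈ p.support, x = u ∨ x = w ∨ x ∈ t') ↔
      (G.Adj u w ∨ ∃ m, IsMaxBelow T t m ∧ (∃ x ∈ m, G.Adj u x) ∧ ∃ y ∈ m, G.Adj w y)) := by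
    intro u w hne
    constructor
    · rintro (h | ⟨t', ht', ht, p, hp⟩)
      · exact Or.inl h
      · obtain ⟨m, hm, hle⟩ := exists_isMaxBelow ht' ht
        rcases adj_or_exists_adj_of_walk t' p hne hp with h | ⟨x, hx, hux⟩
        · exact Or.inl h
        rcases adj_or_exists_adj_of_walk t' p.reverse hne.symm
          (fun z hz => by have := hp z (by simpa using hz); tauto) with h | ⟨y, hy, hwy⟩
        · exact Or.inl h.symm
        exact Or.inr ⟨m, hm, ⟨x, hle hx, hux⟩, y, hle hy, hwy⟩
    · rintro (h | ⟨m, hm, ⟨x, hx, hux⟩, y, hy, hwy⟩)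
      · exact Or.inl h
      · exact Or.inr ⟨m, hm.prop.1, hm.prop.2,
          exists_walk_through (hT.1 m hm.prop.1).2.2 hx hy hux hwy⟩
  rw [coreGraph, SimpleGraph.fromRel_adj]
  constructor
  · rintro ⟨hne, ⟨hu, hw, h⟩ | ⟨hw, hu, h⟩⟩
    · exact ⟨hne, hu, hw, (key u w hne).1 h⟩
    · refine ⟨hne, hu, hw, ?_⟩
      rcases (key w u hne.symm).1 h with h | ⟨m, hm, h₁, h₂⟩
      · exact Or.inl h.symm
      · exact Or.inr ⟨m, hm, h₂, h₁⟩
  · rintro ⟨hne, hu, hw, h⟩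
    exact ⟨hne, Or.inl ⟨hu, hw, (key u w hne).2 h⟩⟩

/-- The tubes `h` of `G` with `h ⊂ t` that lie in no smaller tube of `T` and are compatible
with `T`. -/
def IsTubeAbove [Fintype V] (G : SimpleGraph V) (T : Finset (Finset V)) (t h : Finset V) : Prop :=
  IsTube G h ∧ h ⊂ t ∧ (∀ t' ∈ T, t' ⊂ t → ¬ h ⊆ t') ∧ ∀ t' ∈ T, t' ≠ h → Compatible G h t'

theorem IsTubeAbove.ssubset_or_disjoint [Fintype V] {G : SimpleGraph V} {T : Finset (Finset V)}
    {t h m : Finset V} (hh : IsTubeAbove G T t h) (hm : IsMaxBelow T t m) :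
    m ⊂ h ∨ (Disjoint h m ∧ ∀ u ∈ h, ∀ w ∈ m, ¬ G.Adj u w) := by
  obtain ⟨-, -, hnot, hcomp⟩ := hh
  have hnm := hnot m hm.prop.1 hm.prop.2
  rcases hcomp m hm.prop.1 (by rintro rfl; exact hnm subset_rfl) with h' | h' | h'
  · exact absurd h'.1 hnm
  · exact Or.inl h'
  · exact Or.inr h'

theorem IsTubeAbove.ssubset_of_mem [Fintype V] {G : SimpleGraph V} {T : Finset (Finset V)}
    {t h m : Finset V} (hh : IsTubeAbove G T t h) (hm : IsMaxBelow T t m) {v : V} (hv : v ∈ h)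
    (hvm : v ∈ m) : m ⊂ h :=
  (hh.ssubset_or_disjoint hm).resolve_right fun h' => Finset.disjoint_left.1 h'.1 hv hvm

theorem IsTubeAbove.ssubset_of_adj [Fintype V] {G : SimpleGraph V} {T : Finset (Finset V)}
    {t h m : Finset V} (hh : IsTubeAbove G T t h) (hm : IsMaxBelow T t m) {v w : V} (hv : v ∈ h)
    (hw : w ∈ m) (hvw : G.Adj v w) : m ⊂ h :=
  (hh.ssubset_or_disjoint hm).resolve_right fun h' => h'.2 v hv w hw hvw

theorem mem_sdiff_sup_below_iff [DecidableEq V] {T : Finset (Finset V)} {t h : Finset V} {v : V} :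
    v ∈ h \ (T.filter (fun t' => t' ⊂ t)).sup id ↔ v ∈ h ∧ ∀ m, IsMaxBelow T t m → v ∉ m := by
  simp only [Finset.mem_sdiff, mem_sup_below_iff, not_exists, not_and]

theorem IsTubeAbove.isCoreTube [Fintype V] [DecidableEq V] {G : SimpleGraph V}
    {T : Finset (Finset V)} (hT : IsTubing G T) {t h : Finset V} (ht : t ∈ T)
    (hh : IsTubeAbove G T t h) :
    IsCoreTube G T t (h \ (T.filter (fun t' => t' ⊂ t)).sup id) := by
  have hconn := hh.1.2.2
  have hne : (h \ (T.filter (fun t' => t' ⊂ t)).sup id).Nonempty := by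
    obtain ⟨v, hv⟩ := hh.1.1
    by_cases hvU : ∀ m, IsMaxBelow T t m → v ∉ m
    · exact ⟨v, mem_sdiff_sup_below_iff.2 ⟨hv, hvU⟩⟩
    · push Not at hvU
      obtain ⟨m, hm, hvm⟩ := hvU
      obtain ⟨x, -, y, hy, -, hyU⟩ :=
        hT.exists_adj_of_isMaxBelow hm hconn (hh.ssubset_of_mem hm hv hvm)
      exact ⟨y, mem_sdiff_sup_below_iff.2 ⟨hy, hyU⟩⟩
  refine ⟨?_, hne, ?_, ?_⟩
  · intro v hv
    rw [mem_sdiff_sup_below_iff] at hv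
    exact mem_coreVerts_iff.2 ⟨hh.2.1.1 hv.1, hv.2⟩
  · intro heq
    have hcore : ∀ v ∈ t, (∀ m, IsMaxBelow T t m → v ∉ m) → v ∈ h := fun v hv hvU =>
      (mem_sdiff_sup_below_iff.1 (heq ▸ mem_coreVerts_iff.2 ⟨hv, hvU⟩)).1
    obtain ⟨v, hvt, hvh⟩ := Finset.exists_of_ssubset hh.2.1
    have hvU : ¬ ∀ m, IsMaxBelow T t m → v ∉ m := fun hvU => hvh (hcore v hvt hvU)
    push Not at hvU
    obtain ⟨m, hm, hvm⟩ := hvU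
    obtain ⟨x, hx, y, hy, hxy, hyU⟩ :=
      hT.exists_adj_of_isMaxBelow hm (hT.1 t ht).2.2 hm.prop.2
    exact hvh ((hh.ssubset_of_adj hm (hcore y hy hyU) hx hxy.symm).1 hvm)
  · rw [induce_connected_iff_cut]
    refine ⟨hne, ?_⟩
    rintro A ⟨a, ha, haA⟩ ⟨b, hb, hbA⟩
    have hcore : ∀ v ∈ h, (∀ m, IsMaxBelow T t m → v ∉ m) → v ∈ coreVerts T t :=
      fun v hv hvU => mem_coreVerts_iff.2 ⟨hh.2.1.1 hv, hvU⟩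
    simp only [Finset.mem_coe, mem_sdiff_sup_below_iff] at ha hb ⊢
    obtain ⟨-, hcut⟩ := (induce_connected_iff_cut _ _).1 hconn
    obtain ⟨x, hx, hxB, y, hy, hyB, hxy⟩ := hcut
      {v | (v ∈ A ∧ ∀ m, IsMaxBelow T t m → v ∉ m) ∨ ∃ m, IsMaxBelow T t m ∧ v ∈ m ∧
        ∃ z ∈ h, z ∈ A ∧ (∀ m, IsMaxBelow T t m → z ∉ m) ∧ ∃ x ∈ m, G.Adj z x}
      ⟨a, ha.1, Or.inl ⟨haA, ha.2⟩⟩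
      ⟨b, hb.1, by
        rintro (h' | ⟨m, hm, hbm, -⟩)
        · exact hbA h'.1
        · exact hb.2 m hm hbm⟩
    simp only [Set.mem_ofPred_eq, not_or, not_and, not_exists] at hxB hyB
    obtain ⟨hyA, hyM⟩ := hyB
    rcases hxB with ⟨hxA, hxU⟩ | ⟨m, hm, hxm, z, hz, hzA, hzU, x', hx', hzx'⟩
    · have hyU : ∀ m, IsMaxBelow T t m → y ∉ m := fun m hm hym =>
        hyM m hm hym x hx hxA hxU y hym hxy
      exact ⟨x, ⟨hx, hxU⟩, hxA, y, ⟨hy, hyU⟩, fun hA => hyA hA hyU,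
        hT.coreGraph_adj_iff.2 ⟨hxy.ne, hcore x hx hxU, hcore y hy hyU, Or.inl hxy⟩⟩
    · have hyU : ∀ m, IsMaxBelow T t m → y ∉ m := by
        intro m' hm' hym'
        obtain rfl := hT.isMaxBelow_eq hm hm' hxm hym' (Or.inr hxy)
        exact hyM m hm hym' z hz hzA hzU x' hx' hzx'
      have hyA' : y ∉ A := fun hA => hyA hA hyU
      exact ⟨z, ⟨hz, hzU⟩, hzA, y, ⟨hy, hyU⟩, hyA',
        hT.coreGraph_adj_iff.2 ⟨fun e => hyA' (e ▸ hzA), hcore z hz hzU, hcore y hy hyU,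
          Or.inr ⟨m, hm, ⟨x', hx', hzx'⟩, x, hxm, hxy.symm⟩⟩⟩

/-- The core part of `h` together with the maximal tubes touching it recovers `h`. -/
theorem IsTubeAbove.mem_iff [Fintype V] [DecidableEq V] {G : SimpleGraph V}
    {T : Finset (Finset V)} (hT : IsTubing G T) {t h : Finset V} (hh : IsTubeAbove G T t h)
    {v : V} :
    v ∈ h ↔ v ∈ h \ (T.filter (fun t' => t' ⊂ t)).sup id ∨ ∃ m, IsMaxBelow T t m ∧ v ∈ m ∧
      Touches G m (h \ (T.filter (fun t' => t' ⊂ t)).sup id) := by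
  constructor
  · intro hv
    by_cases hvU : ∀ m, IsMaxBelow T t m → v ∉ m
    · exact Or.inl (mem_sdiff_sup_below_iff.2 ⟨hv, hvU⟩)
    · push Not at hvU
      obtain ⟨m, hm, hvm⟩ := hvU
      obtain ⟨x, hx, y, hy, hxy, hyU⟩ :=
        hT.exists_adj_of_isMaxBelow hm hh.1.2.2 (hh.ssubset_of_mem hm hv hvm)
      exact Or.inr ⟨m, hm, hvm, x, hx, y, mem_sdiff_sup_below_iff.2 ⟨hy, hyU⟩, hxy⟩
  · rintro (hv | ⟨m, hm, hvm, x, hx, y, hy, hxy⟩)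
    · exact (Finset.mem_sdiff.1 hv).1
    · exact (hh.ssubset_of_adj hm (Finset.mem_sdiff.1 hy).1 hx hxy.symm).1 hvm

open scoped Classical in
/-- A set of core vertices together with the maximal tubes of `T` below `t` touching it. -/
noncomputable def coreLift [Fintype V] (G : SimpleGraph V) (T : Finset (Finset V))
    (t s : Finset V) : Finset V :=
  Finset.univ.filter fun v => v ∈ s ∨ ∃ m, IsMaxBelow T t m ∧ v ∈ m ∧ Touches G m s

theorem mem_coreLift_iff [Fintype V] {G : SimpleGraph V} {T : Finset (Finset V)}
    {t s : Finset V} {v : V} :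
    v ∈ coreLift G T t s ↔ v ∈ s ∨ ∃ m, IsMaxBelow T t m ∧ v ∈ m ∧ Touches G m s := by
  simp [coreLift]

theorem coreLift_sdiff [Fintype V] [DecidableEq V] {G : SimpleGraph V} {T : Finset (Finset V)}
    {t s : Finset V} (hs : s ⊆ coreVerts T t) :
    coreLift G T t s \ (T.filter (fun t' => t' ⊂ t)).sup id = s := by
  ext v
  rw [mem_sdiff_sup_below_iff, mem_coreLift_iff]
  constructor
  · rintro ⟨hv | ⟨m, hm, hvm, -⟩, hvU⟩
    · exact hv
    · exact absurd hvm (hvU m hm)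
  · exact fun hv => ⟨Or.inl hv, (mem_coreVerts_iff.1 (hs hv)).2⟩

theorem IsCoreTube.induce_coreLift_connected [Fintype V] [DecidableEq V] {G : SimpleGraph V}
    {T : Finset (Finset V)} (hT : IsTubing G T) {t s : Finset V} (hs : IsCoreTube G T t s) :
    (G.induce (coreLift G T t s : Set V)).Connected := by
  obtain ⟨-, ⟨v₀, hv₀⟩, -, hconn⟩ := hs
  obtain ⟨-, hcut⟩ := (induce_connected_iff_cut _ _).1 hconn
  rw [induce_connected_iff_cut]
  have hsub : ∀ v ∈ s, v ∈ coreLift G T t s := fun v hv => mem_coreLift_iff.2 (Or.inl hv)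
  have hsubm : ∀ m, IsMaxBelow T t m → Touches G m s → ∀ v ∈ m, v ∈ coreLift G T t s :=
    fun m hm hms v hv => mem_coreLift_iff.2 (Or.inr ⟨m, hm, hv, hms⟩)
  refine ⟨⟨v₀, hsub v₀ hv₀⟩, ?_⟩
  rintro A ⟨a, ha, haA⟩ ⟨b, hb, hbA⟩
  by_contra hno
  have closed : ∀ x ∈ coreLift G T t s, ∀ y ∈ coreLift G T t s, G.Adj x y → (x ∈ A ↔ y ∈ A) := by
    intro x hx y hy hxy
    constructor
    · intro hxA
      by_contra hyA
      exact hno ⟨x, hx, hxA, y, hy, hyA, hxy⟩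
    · intro hyA
      by_contra hxA
      exact hno ⟨y, hy, hyA, x, hx, hxA, hxy.symm⟩
  have closedm : ∀ m, IsMaxBelow T t m → Touches G m s → ∀ x ∈ m, ∀ y ∈ m, x ∈ A → y ∈ A := by
    intro m hm hms x hx y hy hxA
    by_contra hyA
    obtain ⟨-, hc⟩ := (induce_connected_iff_cut _ _).1 (hT.1 m hm.prop.1).2.2
    obtain ⟨x', hx', hxA', y', hy', hyA', hxy⟩ := hc A ⟨x, hx, hxA⟩ ⟨y, hy, hyA⟩
    exact hyA' ((closed x' (hsubm m hm hms x' hx') y' (hsubm m hm hms y' hy') hxy).1 hxA')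
  have has : ∃ a ∈ s, a ∈ A := by
    rcases mem_coreLift_iff.1 ha with ha' | ⟨m, hm, ham, hms⟩
    · exact ⟨a, ha', haA⟩
    · obtain ⟨x, hx, y, hy, hxy⟩ := id hms
      exact ⟨y, hy, (closed x (hsubm m hm hms x hx) y (hsub y hy) hxy).1
        (closedm m hm hms a ham x hx haA)⟩
  have hbs : ∃ b ∈ s, b ∉ A := by
    rcases mem_coreLift_iff.1 hb with hb' | ⟨m, hm, hbm, hms⟩
    · exact ⟨b, hb', hbA⟩
    · obtain ⟨x, hx, y, hy, hxy⟩ := id hms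
      exact ⟨y, hy, fun hyA => hbA (closedm m hm hms x hx b hbm
        ((closed x (hsubm m hm hms x hx) y (hsub y hy) hxy).2 hyA))⟩
  obtain ⟨x, hx, hxA, y, hy, hyA, hxy⟩ := hcut A has hbs
  obtain ⟨-, -, -, hadj | ⟨m, hm, ⟨x', hx', hxx'⟩, y', hy', hyy'⟩⟩ := hT.coreGraph_adj_iff.1 hxy
  · exact hyA ((closed x (hsub x hx) y (hsub y hy) hadj).1 hxA)
  · have hms : Touches G m s := ⟨x', hx', x, hx, hxx'.symm⟩
    have hx'A := (closed x (hsub x hx) x' (hsubm m hm hms x' hx') hxx').1 hxA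
    have hy'A := closedm m hm hms x' hx' y' hy' hx'A
    exact hyA ((closed y (hsub y hy) y' (hsubm m hm hms y' hy') hyy').2 hy'A)

theorem IsCoreTube.coreLift_ssubset [Fintype V] [DecidableEq V] {G : SimpleGraph V}
    {T : Finset (Finset V)} {t s : Finset V} (hs : IsCoreTube G T t s) :
    coreLift G T t s ⊂ t := by
  refine Finset.ssubset_iff_subset_ne.2 ⟨fun v hv => ?_, fun heq => hs.2.2.1 ?_⟩
  · rcases mem_coreLift_iff.1 hv with hv | ⟨m, hm, hvm, -⟩
    · exact (mem_coreVerts_iff.1 (hs.1 hv)).1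
    · exact hm.prop.2.1 hvm
  · rw [← coreLift_sdiff (G := G) hs.1, heq, coreVerts]

theorem IsCoreTube.isTubeAbove_coreLift [Fintype V] [DecidableEq V] {G : SimpleGraph V}
    {T : Finset (Finset V)} (hT : IsTubing G T) {t s : Finset V} (ht : t ∈ T)
    (hs : IsCoreTube G T t s) : IsTubeAbove G T t (coreLift G T t s) := by
  have hlt := hs.coreLift_ssubset
  obtain ⟨v₀, hv₀⟩ := hs.2.1
  have hv₀' : v₀ ∈ coreLift G T t s := mem_coreLift_iff.2 (Or.inl hv₀)
  refine ⟨⟨⟨v₀, hv₀'⟩, ?_, hs.induce_coreLift_connected hT⟩, hlt, ?_, ?_⟩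
  · rintro heq
    exact hlt.2 (heq ▸ Finset.subset_univ t)
  · intro t' ht' htt' hle
    obtain ⟨m, hm, hle'⟩ := exists_isMaxBelow ht' htt'
    exact (mem_coreVerts_iff.1 (hs.1 hv₀)).2 m hm (hle' (hle hv₀'))
  · intro t' ht' hne
    by_cases hEq : t' = t
    · exact Or.inl (hEq ▸ hlt)
    rcases hT.2 t' ht' t ht hEq with h | h | ⟨hd, hadj⟩
    · obtain ⟨m, hm, hle⟩ := exists_isMaxBelow ht' h
      by_cases hms : Touches G m s
      · refine Or.inr (Or.inl (Finset.ssubset_iff_subset_ne.2 ⟨fun v hv => ?_, hne⟩))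
        exact mem_coreLift_iff.2 (Or.inr ⟨m, hm, hle hv, hms⟩)
      · have hsep : ∀ x ∈ coreLift G T t s, ∀ y ∈ m, x ≠ y ∧ ¬ G.Adj x y := by
          intro x hx y hy
          rcases mem_coreLift_iff.1 hx with hx | ⟨m', hm', hxm', hms'⟩
          · refine ⟨?_, fun hxy => hms ⟨y, hy, x, hx, hxy.symm⟩⟩
            rintro rfl
            exact (mem_coreVerts_iff.1 (hs.1 hx)).2 m hm hy
          · have hn : ¬ (x = y ∨ G.Adj x y) := fun hxy =>
              hms (hT.isMaxBelow_eq hm' hm hxm' hy hxy ▸ hms')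
            exact not_or.1 hn
        refine Or.inr (Or.inr ⟨?_, fun u hu w hw => (hsep u hu w (hle hw)).2⟩)
        exact Finset.disjoint_left.2 fun x hx hx' => (hsep x hx x (hle hx')).1 rfl
    · exact Or.inl (hlt.trans h)
    · refine Or.inr (Or.inr ⟨(hd.mono_right hlt.1).symm, fun u hu w hw huw => ?_⟩)
      exact hadj w hw u (hlt.1 hu) huw.symm

/-- The map `h ↦ h ∖ ⋃ {t' ∈ T : t' ⊊ t}` is a bijection from the tubes `h`
of `G` with `h ⊊ t`, `h` contained in no tube `t' ∈ T` with `t' ⊊ t`, and `h` compatible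
with every tube of `T`, onto the tubes of the core graph `ℛ(t, T)`. -/
theorem core_tube_bijection [Fintype V] [DecidableEq V] (G : SimpleGraph V)
    (T : Finset (Finset V)) (hT : IsTubing G T) (t : Finset V) (ht : t ∈ T) :
    Set.BijOn (fun h => h \ (T.filter (fun t' => t' ⊂ t)).sup id)
      {h : Finset V | IsTube G h ∧ h ⊂ t ∧ (∀ t' ∈ T, t' ⊂ t → ¬ h ⊆ t') ∧
        ∀ t' ∈ T, t' ≠ h → Compatible G h t'}
      {s : Finset V | IsCoreTube G T t s} := by
  refine ⟨fun h hh => IsTubeAbove.isCoreTube hT ht hh, fun h₁ hh₁ h₂ hh₂ heq => ?_,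
    fun s hs => ⟨coreLift G T t s, IsCoreTube.isTubeAbove_coreLift hT ht hs,
      coreLift_sdiff hs.1⟩⟩
  ext v
  have heq' : h₁ \ (T.filter (fun t' => t' ⊂ t)).sup id =
      h₂ \ (T.filter (fun t' => t' ⊂ t)).sup id := heq
  rw [IsTubeAbove.mem_iff hT hh₁, IsTubeAbove.mem_iff hT hh₂, heq']

end ColorfulGA
end

section
/- Let G be a connected simple graph with at least 3 vertices that has a cut vertex (a vertex whose removal leaves a disconnected induced subgraph). Then there exists a vertex w of G such that the induced subgraph G−w on the remaining vertices is connected and has connectivity 1; that is, G−w is connected, and either G−w has exactly two vertices or G−w has a cut vertex. -/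
namespace ColorfulGA

/-- `H` has a cut vertex: a vertex whose removal leaves a disconnected (nonempty, not
preconnected) induced subgraph. -/
def HasCutVertex {W : Type*} (H : SimpleGraph W) : Prop :=
  ∃ x : W, ¬ (H.induce {y | y ≠ x}).Preconnected

theorem exists_adj_dist_lt {V : Type*} {G : SimpleGraph V} (hG : G.Connected) {x v : V}
    (hv : v ≠ x) : ∃ u, G.Adj v u ∧ G.dist u x < G.dist v x := by
  obtain ⟨p, hp⟩ := hG.exists_walk_length_eq_dist v x
  cases p with
  | nil => exact absurd rfl hv
  | cons h q =>
    have := SimpleGraph.dist_le q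
    rw [SimpleGraph.Walk.length_cons] at hp
    exact ⟨_, h, by omega⟩

/-- In a set of vertices attached to the rest of the graph only through `x`, some vertex (one
farthest from `x`) can be deleted without disconnecting the graph. -/
theorem exists_mem_connected_induce_ne {V : Type*} {G : SimpleGraph V} (hG : G.Connected) {x : V}
    {S : Set V} (hfin : S.Finite) (hne : S.Nonempty) (hx : x ∉ S)
    (hS : ∀ u ∈ S, ∀ v, G.Adj u v → v ≠ x → v ∈ S) :
    ∃ w ∈ S, (G.induce {v | v ≠ w}).Connected := by
  obtain ⟨w, hw, hmax⟩ := S.exists_max_image (fun v => G.dist v x) hfin hne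
  have hxw : x ≠ w := fun h => hx (h ▸ hw)
  have hreach : ∀ n, ∀ v (hv : v ≠ w), G.dist v x = n →
      (G.induce {v | v ≠ w}).Reachable ⟨v, hv⟩ ⟨x, hxw⟩ := by
    intro n
    induction n using Nat.strong_induction_on with
    | _ n ih =>
      intro v hv hn
      by_cases hvx : v = x
      · subst hvx
        exact SimpleGraph.Reachable.refl _
      obtain ⟨u, huv, hlt⟩ := exists_adj_dist_lt hG hvx
      have huw : u ≠ w := by
        rintro rfl
        exact absurd (hmax v (hS u hw v huv.symm hvx)) (not_le.mpr hlt)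
      have hadj : (G.induce {v | v ≠ w}).Adj ⟨v, hv⟩ ⟨u, huw⟩ := huv
      exact hadj.reachable.trans (ih _ (hn ▸ hlt) u huw rfl)
  refine ⟨w, hw, (SimpleGraph.connected_iff _).mpr ⟨fun u v => ?_, ⟨⟨x, hxw⟩⟩⟩⟩
  exact (hreach _ u.1 u.2 rfl).trans (hreach _ v.1 v.2 rfl).symm

theorem exists_connected_induce_ne_of_not_reachable {V : Type*} [Finite V] {G : SimpleGraph V}
    (hG : G.Connected) {x : V} {a b : {y : V | y ≠ x}}
    (hab : ¬ (G.induce {y | y ≠ x}).Reachable a b) :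
    ∃ w : {y : V | y ≠ x}, ¬ (G.induce {y | y ≠ x}).Reachable a w ∧
      (G.induce {v | v ≠ w.1}).Connected := by
  obtain ⟨w, ⟨hwx, haw⟩, hw⟩ := exists_mem_connected_induce_ne hG (x := x)
    (S := {v | ∃ h : v ≠ x, ¬ (G.induce {y | y ≠ x}).Reachable a ⟨v, h⟩})
    (Set.toFinite _) ⟨b.1, b.2, hab⟩ (fun h => h.1 rfl) (by
      rintro u ⟨hu, hau⟩ v huv hv
      refine ⟨hv, fun hav => hau (hav.trans ?_)⟩
      have hadj : (G.induce {y | y ≠ x}).Adj ⟨v, hv⟩ ⟨u, hu⟩ := huv.symm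
      exact hadj.reachable)
  exact ⟨⟨w, hwx⟩, haw, hw⟩

theorem hasCutVertex_induce_ne {V : Type*} {G : SimpleGraph V} {x w : V} (hxw : x ≠ w)
    {a b : {y : V | y ≠ x}} (hab : ¬ (G.induce {y | y ≠ x}).Reachable a b)
    (ha : a.1 ≠ w) (hb : b.1 ≠ w) : HasCutVertex (G.induce {v | v ≠ w}) := by
  refine ⟨⟨x, hxw⟩, fun h => hab ?_⟩
  let f : (G.induce {v | v ≠ w}).induce {y | y ≠ ⟨x, hxw⟩} →g G.induce {y | y ≠ x} :=
    ⟨fun v => ⟨v.1.1, fun e => v.2 (Subtype.ext e)⟩, fun hadj => hadj⟩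
  exact (h ⟨⟨a.1, ha⟩, fun e => a.2 (congrArg Subtype.val e)⟩
    ⟨⟨b.1, hb⟩, fun e => b.2 (congrArg Subtype.val e)⟩).map f

theorem exists_connected_hasCutVertex_induce_ne {V : Type*} [Finite V] {G : SimpleGraph V}
    (hG : G.Connected) {x : V} {a b c : {y : V | y ≠ x}} (hbc : b ≠ c)
    (hab : ¬ (G.induce {y | y ≠ x}).Reachable a b)
    (hac : ¬ (G.induce {y | y ≠ x}).Reachable a c) :
    ∃ w : V, (G.induce {v | v ≠ w}).Connected ∧ HasCutVertex (G.induce {v | v ≠ w}) := by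
  obtain ⟨w, haw, hw⟩ := exists_connected_induce_ne_of_not_reachable hG hab
  have ha : a.1 ≠ w.1 := fun e => haw (Subtype.ext e ▸ SimpleGraph.Reachable.refl _)
  refine ⟨w, hw, ?_⟩
  by_cases hb : b = w
  · exact hasCutVertex_induce_ne w.2.symm hac ha fun e => hbc (hb.trans (Subtype.ext e).symm)
  · exact hasCutVertex_induce_ne w.2.symm hab ha fun e => hb (Subtype.ext e)

/-- If `G` is a connected simple graph with at least 3 vertices having a cut
vertex, then there is a vertex `w` such that `G - w` is connected and has connectivity 1,
i.e. `G - w` is connected and either has exactly two vertices or has a cut vertex. -/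
theorem exists_vertex_removal_connectivity_one {V : Type} [Fintype V] (G : SimpleGraph V)
    (hG : G.Connected) (h3 : 3 ≤ Fintype.card V) (hcut : HasCutVertex G) :
    ∃ w : V, (G.induce {v | v ≠ w}).Connected ∧
      (Nat.card {v : V // v ≠ w} = 2 ∨ HasCutVertex (G.induce {v | v ≠ w})) := by
  classical
  obtain ⟨x, hx⟩ := hcut
  simp only [SimpleGraph.Preconnected, not_forall] at hx
  obtain ⟨a, b, hab⟩ := hx
  obtain h3 | h4 := h3.eq_or_lt
  · obtain ⟨w, -, hw⟩ := exists_connected_induce_ne_of_not_reachable hG hab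
    refine ⟨w, hw, Or.inl ?_⟩
    rw [Nat.card_eq_fintype_card, Fintype.card_subtype_compl, Fintype.card_subtype_eq, ← h3]
  obtain ⟨c, hc⟩ : ∃ c, c ∉ ({x, a.1, b.1} : Finset V) := by
    by_contra! h
    have := Finset.card_le_card (fun v _ => h v : Finset.univ ⊆ ({x, a.1, b.1} : Finset V))
    have := Finset.card_le_three (a := x) (b := a.1) (c := b.1)
    rw [Finset.card_univ] at *
    omega
  simp only [Finset.mem_insert, Finset.mem_singleton, not_or] at hc
  obtain ⟨hcx, hca, hcb⟩ := hc
  by_cases hac : (G.induce {y | y ≠ x}).Reachable a ⟨c, hcx⟩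
  · obtain ⟨w, hw, hw'⟩ := exists_connected_hasCutVertex_induce_ne hG (c := ⟨c, hcx⟩)
      (fun e => hca (congrArg Subtype.val e).symm) (fun h => hab h.symm)
      (fun h => hab (hac.trans h.symm))
    exact ⟨w, hw, Or.inr hw'⟩
  · obtain ⟨w, hw, hw'⟩ := exists_connected_hasCutVertex_induce_ne hG
      (fun e => hcb (congrArg Subtype.val e).symm) hab hac
    exact ⟨w, hw, Or.inr hw'⟩

end ColorfulGA
end

section
/- Let H be a connected simple graph with at least two vertices. Suppose t₁ and t₂ are distinct tubes of H that are not compatible with each other, and each of t₁ and t₂ is compatible with every tube of H other than t₁ and t₂. Then H has exactly two vertices. -/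
namespace ColorfulGA

variable {V : Type} {α : Type}

/-- In a connected graph, every nonempty proper vertex set is left by an edge. -/
theorem exists_adj_of_ne_univ [Fintype V] {G : SimpleGraph V} (hG : G.Connected)
    {s : Finset V} (hs : s.Nonempty) (hs' : s ≠ Finset.univ) :
    ∃ a ∈ s, ∃ b, b ∉ s ∧ G.Adj a b := by
  obtain ⟨x, hx⟩ := hs
  obtain ⟨y, hy⟩ : ∃ y, y ∉ s := by
    by_contra! h
    exact hs' (Finset.eq_univ_iff_forall.2 h)
  obtain ⟨p⟩ := hG.preconnected x y
  obtain ⟨d, -, h₁, h₂⟩ := p.exists_boundary_dart (s : Set V) hx hy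
  exact ⟨d.fst, h₁, d.snd, h₂, d.adj⟩

theorem isTube_singleton [Fintype V] (G : SimpleGraph V) (h2 : 2 ≤ Fintype.card V) (v : V) :
    IsTube G {v} := by
  refine ⟨Finset.singleton_nonempty v, fun h => ?_, ?_⟩
  · have := congrArg Finset.card h
    rw [Finset.card_singleton, Finset.card_univ] at this
    omega
  · rw [Finset.coe_singleton]
    exact SimpleGraph.Connected.of_subsingleton

/-- A nonempty set is incompatible with a neighbouring vertex outside of it. -/
theorem not_compatible_singleton {G : SimpleGraph V} {s : Finset V} {a b : V}
    (ha : a ∈ s) (hb : b ∉ s) (hab : G.Adj a b) : ¬ Compatible G s {b} := by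
  rintro (h | h | ⟨-, h⟩)
  · exact hb (Finset.mem_singleton.1 (h.1 ha) ▸ ha)
  · exact hb (h.1 (Finset.mem_singleton_self b))
  · exact h a ha b (Finset.mem_singleton_self b) hab

/-- If a tube is compatible with every tube other than itself and `t`, then `t` is a single
vertex. -/
theorem exists_eq_singleton_of_compatible [Fintype V] {G : SimpleGraph V} (hG : G.Connected)
    (h2 : 2 ≤ Fintype.card V) {s t : Finset V} (hs : IsTube G s)
    (hcomp : ∀ r : Finset V, IsTube G r → r ≠ s → r ≠ t → Compatible G s r) :
    ∃ v, t = {v} := by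
  obtain ⟨a, ha, b, hb, hab⟩ := exists_adj_of_ne_univ hG hs.1 hs.2.1
  refine ⟨b, ?_⟩
  by_contra h
  refine not_compatible_singleton ha hb hab (hcomp _ (isTube_singleton G h2 b) ?_ (Ne.symm h))
  rintro rfl
  exact hb (Finset.mem_singleton_self b)

/-- If `H` is a connected simple graph with at least two vertices possessing
two distinct tubes `t₁`, `t₂` that are incompatible with each other but each compatible
with every other tube of `H`, then `H` has exactly two vertices. -/
theorem two_vertices_of_exceptional_tubes [Fintype V] (H : SimpleGraph V)
    (hH : H.Connected) (h2 : 2 ≤ Fintype.card V)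
    (t₁ t₂ : Finset V) (ht₁ : IsTube H t₁) (ht₂ : IsTube H t₂) (hne : t₁ ≠ t₂)
    (hincomp : ¬ Compatible H t₁ t₂)
    (hcomp₁ : ∀ s : Finset V, IsTube H s → s ≠ t₁ → s ≠ t₂ → Compatible H t₁ s)
    (hcomp₂ : ∀ s : Finset V, IsTube H s → s ≠ t₁ → s ≠ t₂ → Compatible H t₂ s) :
    Fintype.card V = 2 := by
  classical
  obtain ⟨v, rfl⟩ := exists_eq_singleton_of_compatible hH h2 ht₁ hcomp₁
  obtain ⟨w, rfl⟩ := exists_eq_singleton_of_compatible hH h2 ht₂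
    fun r hr h h' => hcomp₂ r hr h' h
  have hwv : w ≠ v := fun h => hne (h ▸ rfl)
  suffices h : ({w, v} : Finset V) = Finset.univ by
    rw [← Finset.card_univ, ← h, Finset.card_pair hwv]
  by_contra h
  obtain ⟨a, ha, b, hb, hab⟩ := exists_adj_of_ne_univ hH (Finset.insert_nonempty w {v}) h
  simp only [Finset.mem_insert, Finset.mem_singleton, not_or] at ha hb
  have hbw : ({b} : Finset V) ≠ {w} := fun h => hb.1 (Finset.singleton_injective h)
  have hbv : ({b} : Finset V) ≠ {v} := fun h => hb.2 (Finset.singleton_injective h)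
  have htube := isTube_singleton H h2 b
  rcases ha with rfl | rfl
  · exact not_compatible_singleton (Finset.mem_singleton_self a)
      (by simpa using hb.1) hab (hcomp₁ _ htube hbw hbv)
  · exact not_compatible_singleton (Finset.mem_singleton_self a)
      (by simpa using hb.2) hab (hcomp₂ _ htube hbw hbv)

end ColorfulGA
end
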